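/- There exist an absolute constant c > 0 and n₀ ∈ ℕ such that for every n ≥ n₀ there is a convex body C in ℝⁿ whose centroid g(C) and Santaló point s(C) satisfy c ≤ ‖g(C) − s(C)‖₂ / w_C(u), where u = (g(C) − s(C))/‖g(C) − s(C)‖₂ and w_C(u) = h_C(u) + h_C(−u) is the width of C in direction u. -/

import Mathlib

open MeasureTheory
open scoped Pointwise RealInnerProductSpace

/-- The centroid (center of gravity) of a set `K`: `(1/vol K) ∫_K x dx`. -/
noncomputable def centroid {E : Type*} [NormedAddCommGroup E] [NormedSpace ℝ E]
    [MeasureSpace E] (K : Set E) : E :=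
  ((volume K).toReal)⁻¹ • ∫ x in K, x

/-- The polar of `K` with respect to `x`: `K^x = {y : ⟨y, z - x⟩ ≤ 1 for all z ∈ K}`. -/
def polarAt {n : ℕ} (K : Set (EuclideanSpace ℝ (Fin n)))
    (x : EuclideanSpace ℝ (Fin n)) : Set (EuclideanSpace ℝ (Fin n)) :=
  {y | ∀ z ∈ K, ⟪y, z - x⟫ ≤ 1}

/-- `x` is a Santaló point of `K`: an interior point of `K` at which
`vol(K)·vol(K^x)` attains its minimum over interior points. -/
def IsSantaloPoint {n : ℕ} (K : Set (EuclideanSpace ℝ (Fin n)))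
    (x : EuclideanSpace ℝ (Fin n)) : Prop :=
  x ∈ interior K ∧
    ∀ y ∈ interior K, volume K * volume (polarAt K x) ≤ volume K * volume (polarAt K y)

/-- The support function `h_K(u) = sup_{x ∈ K} ⟨u, x⟩`. -/
noncomputable def suppFn {n : ℕ} (K : Set (EuclideanSpace ℝ (Fin n)))
    (u : EuclideanSpace ℝ (Fin n)) : ℝ :=
  sSup ((fun x => ⟪u, x⟫) '' K)


namespace SantaloAux

open Set

lemma lint_split (f : ℝ → ENNReal) (a : ℝ) :
    ∫⁻ x, f x = (∫⁻ x in Iic a, f x) + ∫⁻ x in Ioi a, f x := by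
  rw [← compl_Iic, lintegral_add_compl _ measurableSet_Iic]

lemma lint_Ioi {a : ℝ} (ha : a < 0) (c : ℝ) :
    ∫⁻ x in Ioi c, ENNReal.ofReal (Real.exp (a * x))
      = ENNReal.ofReal (- Real.exp (a * c) / a) := by
  rw [← integral_exp_mul_Ioi ha, ofReal_integral_eq_lintegral_ofReal (integrableOn_exp_mul_Ioi ha c)]
  exact Filter.Eventually.of_forall fun x => (Real.exp_pos _).le

lemma lint_Iic {a : ℝ} (ha : 0 < a) (c : ℝ) :
    ∫⁻ x in Iic c, ENNReal.ofReal (Real.exp (a * x))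
      = ENNReal.ofReal (Real.exp (a * c) / a) := by
  rw [← integral_exp_mul_Iic ha, ofReal_integral_eq_lintegral_ofReal (integrableOn_exp_mul_Iic ha c)]
  exact Filter.Eventually.of_forall fun x => (Real.exp_pos _).le

lemma lint_abs {a : ℝ} (ha : 0 < a) :
    ∫⁻ x : ℝ, ENNReal.ofReal (Real.exp (-(a * |x|))) = ENNReal.ofReal (2 / a) := by
  rw [lint_split _ 0]
  have h1 : ∫⁻ x in Iic (0:ℝ), ENNReal.ofReal (Real.exp (-(a * |x|)))
      = ∫⁻ x in Iic (0:ℝ), ENNReal.ofReal (Real.exp (a * x)) := by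
    refine setLIntegral_congr_fun measurableSet_Iic fun x hx => ?_
    simp only [abs_of_nonpos (mem_Iic.1 hx)]; ring_nf
  have h2 : ∫⁻ x in Ioi (0:ℝ), ENNReal.ofReal (Real.exp (-(a * |x|)))
      = ∫⁻ x in Ioi (0:ℝ), ENNReal.ofReal (Real.exp (-a * x)) := by
    refine setLIntegral_congr_fun measurableSet_Ioi fun x hx => ?_
    simp only [abs_of_pos (mem_Ioi.1 hx)]; ring_nf
  rw [h1, h2, lint_Iic ha, lint_Ioi (by linarith), ← ENNReal.ofReal_add]
  · congr 1; simp; ring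
  · positivity
  · simp; positivity

lemma lint_tau {t b : ℝ} (h0 : 0 < t) (h1 : t < 1) :
    ∫⁻ τ : ℝ, ENNReal.ofReal (Real.exp (-(max b (τ + 2 * b)) + t * τ))
      = ENNReal.ofReal (1 / (t * (1 - t))) * ENNReal.ofReal (Real.exp (-((1 + t) * b))) := by
  have h1' : 0 < 1 - t := by linarith
  rw [lint_split _ (-b)]
  have e1 : ∫⁻ τ in Iic (-b), ENNReal.ofReal (Real.exp (-(max b (τ + 2 * b)) + t * τ))
      = ENNReal.ofReal (Real.exp (-b)) * ∫⁻ x in Iic (-b), ENNReal.ofReal (Real.exp (t * x)) := by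
    rw [← lintegral_const_mul _ (by fun_prop)]
    refine setLIntegral_congr_fun measurableSet_Iic fun x hx => ?_
    have : x ≤ -b := hx
    rw [max_eq_left (by linarith), Real.exp_add, ENNReal.ofReal_mul (Real.exp_pos _).le]
  have e2 : ∫⁻ τ in Ioi (-b), ENNReal.ofReal (Real.exp (-(max b (τ + 2 * b)) + t * τ))
      = ENNReal.ofReal (Real.exp (-(2 * b))) *
        ∫⁻ x in Ioi (-b), ENNReal.ofReal (Real.exp (-(1 - t) * x)) := by
    rw [← lintegral_const_mul _ (by fun_prop)]
    refine setLIntegral_congr_fun measurableSet_Ioi fun x hx => ?_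
    have : -b < x := hx
    rw [max_eq_right (by linarith), ← ENNReal.ofReal_mul (Real.exp_pos _).le, ← Real.exp_add]
    ring_nf
  rw [e1, e2, lint_Iic h0, lint_Ioi (by linarith), ← ENNReal.ofReal_mul (by positivity),
    ← ENNReal.ofReal_mul (by positivity), ← ENNReal.ofReal_add, ← ENNReal.ofReal_mul (by positivity)]
  · congr 1
    rw [neg_div_neg_eq, mul_div_assoc', mul_div_assoc', ← Real.exp_add, ← Real.exp_add]
    have a1 : -b + t * -b = -((1 + t) * b) := by ring
    have a2 : -(2 * b) + -(1 - t) * -b = -((1 + t) * b) := by ring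
    rw [a1, a2]
    field_simp
    ring
  · positivity
  · rw [neg_div_neg_eq]; positivity

abbrev E (m : ℕ) := EuclideanSpace ℝ (Fin (m + 2))

def Psi (m : ℕ) (x : E m) : ℝ × (ℝ × (Fin m → ℝ)) := (x 0, x 1, fun i => x i.succ.succ)

lemma Psi_mp (m : ℕ) : MeasurePreserving (Psi m) := by
  have h1 := PiLp.volume_preserving_ofLp (Fin (m + 2))
  have h2 := volume_preserving_piFinSuccAbove (fun _ : Fin (m + 2) => ℝ) 0
  have h3 := volume_preserving_piFinSuccAbove (fun _ : Fin (m + 1) => ℝ) 0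
  have h4 := ((MeasurePreserving.id (volume : Measure ℝ)).prod h3).comp (h2.comp h1)
  exact h4

noncomputable def hC {m : ℕ} (y : E m) : ℝ :=
  max |y 1| (y 0 + 2 * |y 1|) + ∑ i : Fin m, |y i.succ.succ|

def body (m : ℕ) : Set (E m) :=
  {x | 0 ≤ x 0 ∧ x 0 ≤ 1 ∧ |x 1| ≤ 1 + x 0 ∧ ∀ i : Fin m, |x i.succ.succ| ≤ 1}

noncomputable def e0 (m : ℕ) : E m := EuclideanSpace.single 0 1

lemma e0_norm (m : ℕ) : ‖e0 m‖ = 1 := by simp [e0]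

noncomputable def R (m : ℕ) : E m ≃ₗᵢ[ℝ] E m := (ℝ ∙ (e0 m)).reflection

lemma inner_e0 {m : ℕ} (x : E m) : ⟪e0 m, x⟫ = x 0 := by
  simp [e0, EuclideanSpace.inner_single_left]

lemma R_apply {m : ℕ} (x : E m) : R m x = (2 * x 0) • e0 m - x := by
  rw [R, Submodule.reflection_apply, Submodule.starProjection_unit_singleton _ (e0_norm m), inner_e0,
    two_smul, ← add_smul, two_mul]

lemma R_zero {m : ℕ} (x : E m) : R m x 0 = x 0 := by
  rw [R_apply]; simp [e0]; ring

lemma R_succ {m : ℕ} (x : E m) (i : Fin (m + 1)) : R m x i.succ = - x i.succ := by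
  rw [R_apply]; simp [e0]

lemma R_one {m : ℕ} (x : E m) : R m x 1 = - x 1 := R_succ x 0

lemma hC_R {m : ℕ} (y : E m) : hC (R m y) = hC y := by
  simp [hC, R_zero, R_succ, R_one]

lemma hC_cont (m : ℕ) : Continuous (hC (m := m)) := by
  unfold hC; fun_prop

lemma body_R {m : ℕ} (x : E m) : R m x ∈ body m ↔ x ∈ body m := by
  simp [body, R_zero, R_succ, R_one]

lemma R_mp (m : ℕ) : MeasurePreserving (R m) := (R m).measurePreserving

lemma inner_eq {m : ℕ} (y x : E m) :
    ⟪y, x⟫ = y 0 * x 0 + (y 1 * x 1 + ∑ i : Fin m, y i.succ.succ * x i.succ.succ) := by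
  rw [PiLp.inner_apply, Fin.sum_univ_succ, Fin.sum_univ_succ]
  simp [mul_comm]

/-- the exponential integral -/
noncomputable def F {m : ℕ} (z : E m) : ENNReal :=
  ∫⁻ y : E m, ENNReal.ofReal (Real.exp (-(hC y) + ⟪y, z⟫))

lemma two_ofReal (a : ℝ) : 2 * ENNReal.ofReal a = ENNReal.ofReal (2 * a) := by
  rw [ENNReal.ofReal_mul (by norm_num)]; simp

lemma F_symm {m : ℕ} (z : E m) : F ((z 0) • e0 m) ≤ F z := by
  have hm := hC_cont m
  have key : F z = ∫⁻ y : E m, ENNReal.ofReal (Real.exp (-(hC y) + (2 * (y 0 * z 0) - ⟪y, z⟫))) := by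
    unfold F
    rw [← (R_mp m).lintegral_comp (by fun_prop)]
    refine lintegral_congr fun y => ?_
    rw [hC_R, R_apply, inner_sub_left, inner_smul_left, inner_e0]
    simp; ring_nf
  have h2 : 2 * F ((z 0) • e0 m) ≤ 2 * F z := by
    rw [two_mul (F z)]
    nth_rewrite 2 [key]
    unfold F
    rw [← lintegral_const_mul _ (by fun_prop), ← lintegral_add_left (by fun_prop)]
    refine lintegral_mono fun y => ?_
    simp only
    rw [inner_smul_right, real_inner_comm, inner_e0, ← ENNReal.ofReal_add (by positivity) (by positivity),
      two_ofReal]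
    apply ENNReal.ofReal_le_ofReal
    rw [Real.exp_add, Real.exp_add, Real.exp_add, ← mul_add, mul_left_comm]
    apply mul_le_mul_of_nonneg_left _ (Real.exp_pos _).le
    set p := y 0 * z 0
    set q := ⟪y, z⟫
    have a1 : Real.exp q = Real.exp p * Real.exp (q - p) := by rw [← Real.exp_add]; ring_nf
    have a2 : Real.exp (2 * p - q) = Real.exp p * Real.exp (-(q - p)) := by
      rw [← Real.exp_add]; ring_nf
    rw [a1, a2, ← mul_add, mul_comm 2, mul_comm (z 0) (y 0)]
    apply mul_le_mul_of_nonneg_left _ (Real.exp_pos _).le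
    have := Real.add_one_le_exp (q - p)
    have := Real.add_one_le_exp (-(q - p))
    linarith
  exact (ENNReal.mul_le_mul_iff_right (by norm_num) (by norm_num)).1 h2

noncomputable def Kc (m : ℕ) : ENNReal :=
  ∫⁻ w : Fin m → ℝ, ENNReal.ofReal (Real.exp (-∑ i, |w i|))

noncomputable def Fint (m : ℕ) (t : ℝ) (p : ℝ × (ℝ × (Fin m → ℝ))) : ENNReal :=
  ENNReal.ofReal (Real.exp (-(max |p.2.1| (p.1 + 2 * |p.2.1|)) + t * p.1)) *
    ENNReal.ofReal (Real.exp (-∑ i, |p.2.2 i|))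

lemma Fint_meas (m : ℕ) (t : ℝ) : Measurable (Fint m t) := by
  unfold Fint; fun_prop

lemma F_axis {m : ℕ} {t : ℝ} (h0 : 0 < t) (h1 : t < 1) :
    F (t • e0 m) = ENNReal.ofReal (1 / (t * (1 - t))) * (ENNReal.ofReal (2 / (1 + t)) * Kc m) := by
  have : F (t • e0 m) = ∫⁻ y : E m, Fint m t (Psi m y) := by
    refine lintegral_congr fun y => ?_
    simp only [Psi, Fint]
    rw [← ENNReal.ofReal_mul (Real.exp_pos _).le, ← Real.exp_add, inner_smul_right,
      real_inner_comm, inner_e0, hC]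
    congr 2
    ring
  rw [this]
  have hM := Fint_meas m t
  rw [(Psi_mp m).lintegral_comp hM]
  rw [Measure.volume_eq_prod,
    lintegral_prod_symm' _ hM]
  have : ∀ y : ℝ × (Fin m → ℝ), ∫⁻ x : ℝ,
      ENNReal.ofReal (Real.exp (-(max |y.1| (x + 2 * |y.1|)) + t * x)) *
        ENNReal.ofReal (Real.exp (-∑ i, |y.2 i|)) =
      ENNReal.ofReal (1 / (t * (1 - t))) * (ENNReal.ofReal (Real.exp (-((1 + t) * |y.1|))) *
        ENNReal.ofReal (Real.exp (-∑ i, |y.2 i|))) := by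
    intro y
    rw [lintegral_mul_const _ (by fun_prop), lint_tau h0 h1, mul_assoc]
  simp only [Fint, this]
  rw [lintegral_const_mul _ (by fun_prop), Measure.volume_eq_prod,
    lintegral_prod_mul (f := fun x : ℝ => ENNReal.ofReal (Real.exp (-((1 + t) * |x|))))
      (g := fun w : Fin m → ℝ => ENNReal.ofReal (Real.exp (-∑ i, |w i|))) (by fun_prop)
      (Measurable.aemeasurable (by fun_prop)),
    lint_abs (by linarith), Kc]


noncomputable def Gn (m : ℕ) : ENNReal :=
  ∫⁻ s in Ioi (0:ℝ), ENNReal.ofReal (Real.exp (-s) * s ^ (m + 2))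

lemma Gn_eq (m : ℕ) : Gn m = ENNReal.ofReal (Real.Gamma (m + 3)) := by
  have hi := Real.GammaIntegral_convergent (s := (m:ℝ) + 3) (by positivity)
  rw [Real.Gamma_eq_integral (by positivity), ofReal_integral_eq_lintegral_ofReal hi, Gn]
  · refine setLIntegral_congr_fun measurableSet_Ioi fun s hs => ?_
    have : (m:ℝ) + 3 - 1 = ((m + 2 : ℕ) : ℝ) := by push_cast; ring
    simp only [this, Real.rpow_natCast]
  · refine (ae_restrict_iff' measurableSet_Ioi).2 (Filter.Eventually.of_forall fun s hs => ?_)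
    have : (0:ℝ) < s := hs
    simp only [Pi.zero_apply]
    positivity

lemma Gn_ne_zero (m : ℕ) : Gn m ≠ 0 := by
  rw [Gn_eq]; simp; exact Real.Gamma_pos_of_pos (by positivity)

lemma Gn_ne_top (m : ℕ) : Gn m ≠ ⊤ := by
  rw [Gn_eq]; simp

lemma layer {m : ℕ} (g : E m → ℝ) (hg : Continuous g) (h0 : ∀ y, 0 ≤ g y)
    (hom : ∀ s : ℝ, 0 < s → ∀ y, g (s • y) = s * g y) :
    ∫⁻ y, ENNReal.ofReal (Real.exp (-(g y))) = Gn m * volume {y | g y ≤ 1} := by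
  have h1 : ∀ y, ENNReal.ofReal (Real.exp (-(g y))) =
      ∫⁻ s in Ioi (0:ℝ), (if g y ≤ s then ENNReal.ofReal (Real.exp (-s)) else 0) := by
    intro y
    have := lint_Ioi (a := -1) (by norm_num) (g y)
    simp only [neg_mul, one_mul, neg_div_neg_eq, div_one] at this
    rw [← this, setLIntegral_congr Ioi_ae_eq_Ici, setLIntegral_congr Ioi_ae_eq_Ici,
      ← lintegral_indicator measurableSet_Ici, ← lintegral_indicator measurableSet_Ici]
    refine lintegral_congr fun s => ?_
    by_cases hs : g y ≤ s
    · have : (0:ℝ) ≤ s := (h0 y).trans hs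
      simp [indicator, hs, this]
    · simp [indicator, hs]
  simp only [h1]
  rw [lintegral_lintegral_swap]
  · rw [Gn, ← lintegral_mul_const _ (by fun_prop)]
    refine setLIntegral_congr_fun measurableSet_Ioi fun s hs => ?_
    have hs : (0:ℝ) < s := hs
    have e1 : ∀ y, (if g y ≤ s then ENNReal.ofReal (Real.exp (-s)) else 0) =
        {y | g y ≤ s}.indicator (fun _ => ENNReal.ofReal (Real.exp (-s))) y := by
      intro y; simp [indicator]
    simp only [e1]
    rw [lintegral_indicator_const (measurableSet_le hg.measurable measurable_const)]
    have e2 : {y | g y ≤ s} = s • {y | g y ≤ 1} := by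
      ext y
      rw [mem_smul_set_iff_inv_smul_mem₀ hs.ne']
      simp only [mem_ofPred_eq]
      rw [hom _ (inv_pos.2 hs), inv_mul_le_iff₀ hs, mul_one]
    rw [e2, Measure.addHaar_smul, ENNReal.ofReal_mul (Real.exp_pos _).le, mul_assoc]
    congr 3
    simp [abs_of_pos hs]
  · apply Measurable.aemeasurable
    refine Measurable.ite (measurableSet_le (hg.measurable.comp measurable_fst) measurable_snd) ?_ ?_
    all_goals fun_prop

lemma inner_le_hC {m : ℕ} (y : E m) {x : E m} (hx : x ∈ body m) : ⟪y, x⟫ ≤ hC y := by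
  obtain ⟨h0, h1, h2, h3⟩ := hx
  rw [inner_eq, hC]
  have a1 : ∑ i : Fin m, y i.succ.succ * x i.succ.succ ≤ ∑ i : Fin m, |y i.succ.succ| := by
    refine Finset.sum_le_sum fun i _ => ?_
    calc _ ≤ |y i.succ.succ * x i.succ.succ| := le_abs_self _
      _ = |y i.succ.succ| * |x i.succ.succ| := abs_mul _ _
      _ ≤ |y i.succ.succ| * 1 := mul_le_mul_of_nonneg_left (h3 i) (abs_nonneg _)
      _ = _ := mul_one _
  have a2 : y 1 * x 1 ≤ |y 1| * (1 + x 0) := by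
    calc _ ≤ |y 1 * x 1| := le_abs_self _
      _ = |y 1| * |x 1| := abs_mul _ _
      _ ≤ _ := mul_le_mul_of_nonneg_left h2 (abs_nonneg _)
  set M := max |y 1| (y 0 + 2 * |y 1|)
  have a3 : |y 1| ≤ M := le_max_left _ _
  have a4 : y 0 + 2 * |y 1| ≤ M := le_max_right _ _
  nlinarith [mul_le_mul_of_nonneg_left a3 (sub_nonneg.2 h1), mul_le_mul_of_nonneg_left a4 h0]

lemma abs_sign_le (a : ℝ) : |(SignType.sign a : ℝ)| ≤ 1 := by
  rcases lt_trichotomy a 0 with h | h | h <;> simp [h]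

noncomputable def wit {m : ℕ} (y : E m) (ε : ℝ) : E m :=
  WithLp.toLp 2 (Fin.cons ε (Fin.cons ((1 + ε) * (SignType.sign (y 1) : ℝ))
    (fun i => (SignType.sign (y i.succ.succ) : ℝ))))

lemma wit_zero {m : ℕ} (y : E m) (ε : ℝ) : wit y ε 0 = ε := rfl
lemma wit_one {m : ℕ} (y : E m) (ε : ℝ) : wit y ε 1 = (1 + ε) * (SignType.sign (y 1) : ℝ) := rfl
lemma wit_succ {m : ℕ} (y : E m) (ε : ℝ) (i : Fin m) :
    wit y ε i.succ.succ = (SignType.sign (y i.succ.succ) : ℝ) := rfl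

lemma wit_mem {m : ℕ} (y : E m) {ε : ℝ} (h0 : 0 ≤ ε) (h1 : ε ≤ 1) : wit y ε ∈ body m := by
  refine ⟨?_, ?_, ?_, fun i => ?_⟩
  · rwa [wit_zero]
  · rwa [wit_zero]
  · rw [wit_zero, wit_one, abs_mul, abs_of_nonneg (by linarith)]
    exact mul_le_of_le_one_right (by linarith) (abs_sign_le _)
  · rw [wit_succ]; exact abs_sign_le _

lemma inner_wit {m : ℕ} (y : E m) (ε : ℝ) :
    ⟪y, wit y ε⟫ = y 0 * ε + ((1 + ε) * |y 1| + ∑ i : Fin m, |y i.succ.succ|) := by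
  rw [inner_eq, wit_zero, wit_one, mul_left_comm, self_mul_sign]
  simp only [wit_succ, self_mul_sign]

lemma exists_hC {m : ℕ} (y : E m) : ∃ x ∈ body m, ⟪y, x⟫ = hC y := by
  rcases le_total |y 1| (y 0 + 2 * |y 1|) with h | h
  · refine ⟨wit y 1, wit_mem y (by norm_num) le_rfl, ?_⟩
    rw [inner_wit, hC, max_eq_right h]; ring
  · refine ⟨wit y 0, wit_mem y le_rfl (by norm_num), ?_⟩
    rw [inner_wit, hC, max_eq_left h]; ring

lemma polar_eq {m : ℕ} (z : E m) : polarAt (body m) z = {y | hC y - ⟪y, z⟫ ≤ 1} := by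
  ext y
  constructor
  · intro h
    obtain ⟨x, hx, hxy⟩ := exists_hC y
    have := h x hx
    rw [inner_sub_right, hxy] at this
    exact this
  · intro h x hx
    have h : hC y - ⟪y, z⟫ ≤ 1 := h
    have := inner_le_hC y hx
    rw [inner_sub_right]; linarith

lemma hC_smul {m : ℕ} {s : ℝ} (hs : 0 < s) (y : E m) : hC (s • y) = s * hC y := by
  simp only [hC, PiLp.smul_apply, smul_eq_mul, abs_mul, abs_of_pos hs, mul_add, Finset.mul_sum,
    mul_max_of_nonneg _ _ hs.le]
  ring_nf

lemma F_eq {m : ℕ} {z : E m} (hz : z ∈ body m) :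
    F z = Gn m * volume (polarAt (body m) z) := by
  rw [polar_eq, ← layer]
  · unfold F
    refine lintegral_congr fun y => ?_
    congr 2; ring
  · have := hC_cont m
    fun_prop
  · intro y
    linarith [inner_le_hC y hz]
  · intro s hs y
    rw [hC_smul hs, inner_smul_left]
    simp; ring

lemma body_closed (m : ℕ) : IsClosed (body m) := by
  have : body m = {x | 0 ≤ x 0} ∩ ({x | x 0 ≤ 1} ∩ ({x | |x 1| ≤ 1 + x 0} ∩
      ⋂ i : Fin m, {x | |x i.succ.succ| ≤ 1})) := by
    ext x; simp [body]
  rw [this]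
  refine (isClosed_le (by fun_prop) (by fun_prop)).inter ((isClosed_le (by fun_prop) (by fun_prop)).inter
    ((isClosed_le (by fun_prop) (by fun_prop)).inter (isClosed_iInter fun i =>
      isClosed_le (by fun_prop) (by fun_prop))))

lemma body_compact (m : ℕ) : IsCompact (body m) := by
  have h : IsCompact (WithLp.toLp 2 '' (Icc (fun _ => (-2:ℝ)) (fun _ => 2)) : Set (E m)) :=
    isCompact_Icc.image (by fun_prop)
  refine h.of_isClosed_subset (body_closed m) ?_
  rintro x ⟨h0, h1, h2, h3⟩
  refine ⟨WithLp.ofLp x, ?_, rfl⟩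
  rw [abs_le] at h2
  have h3 := fun i => abs_le.1 (h3 i)
  constructor
  · intro i
    refine Fin.cases ?_ (fun i => Fin.cases ?_ (fun i => ?_) i) i
    · simp; linarith
    · simp; linarith
    · simp; linarith [(h3 i).1]
  · intro i
    refine Fin.cases ?_ (fun i => Fin.cases ?_ (fun i => ?_) i) i
    · simp; linarith
    · simp; linarith
    · simp; linarith [(h3 i).2]

lemma body_convex (m : ℕ) : Convex ℝ (body m) := by
  rintro x ⟨h0, h1, h2, h3⟩ y ⟨k0, k1, k2, k3⟩ a b ha hb hab
  have key : ∀ p q P Q : ℝ, |p| ≤ P → |q| ≤ Q → |a * p + b * q| ≤ a * P + b * Q := by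
    intro p q P Q hp hq
    calc _ ≤ |a * p| + |b * q| := abs_add_le _ _
      _ = a * |p| + b * |q| := by rw [abs_mul, abs_mul, abs_of_nonneg ha, abs_of_nonneg hb]
      _ ≤ _ := add_le_add (mul_le_mul_of_nonneg_left hp ha) (mul_le_mul_of_nonneg_left hq hb)
  refine ⟨?_, ?_, ?_, fun i => ?_⟩
  · simp; positivity
  · simp; nlinarith
  · simp; have := key _ _ _ _ h2 k2; linarith
  · simp; have := key _ _ _ _ (h3 i) (k3 i); linarith

lemma axis_interior {m : ℕ} {t : ℝ} (h0 : 0 < t) (h1 : t < 1) : t • e0 m ∈ interior (body m) := by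
  rw [mem_interior]
  refine ⟨{x | 0 < x 0} ∩ ({x | x 0 < 1} ∩ ({x | |x 1| < 1 + x 0} ∩
      ⋂ i : Fin m, {x | |x i.succ.succ| < 1})), ?_, ?_, ?_⟩
  · rintro x ⟨a, b, c, d⟩
    refine ⟨le_of_lt a, le_of_lt b, le_of_lt c, fun i => le_of_lt ?_⟩
    exact mem_iInter.1 d i
  · refine (isOpen_lt (by fun_prop) (by fun_prop)).inter ((isOpen_lt (by fun_prop) (by fun_prop)).inter
      ((isOpen_lt (by fun_prop) (by fun_prop)).inter (isOpen_iInter_of_finite fun i =>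
      isOpen_lt (by fun_prop) (by fun_prop))))
  · simp [e0, h0, h1]; linarith

lemma interior_coord {m : ℕ} {y : E m} (hy : y ∈ interior (body m)) : 0 < y 0 ∧ y 0 < 1 := by
  obtain ⟨ε, hε, hb⟩ := Metric.mem_nhds_iff.1 (mem_interior_iff_mem_nhds.1 hy)
  have key : ∀ c : ℝ, |c| < ε → 0 ≤ y 0 + c ∧ y 0 + c ≤ 1 := by
    intro c hc
    have : y + c • e0 m ∈ body m := by
      apply hb
      rw [Metric.mem_ball, dist_eq_norm]
      simpa [norm_smul, e0_norm] using hc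
    have h := And.intro this.1 this.2.1
    simpa [e0] using h
  have a := key (ε / 2) (by rw [abs_of_pos (by linarith)]; linarith)
  have b := key (-(ε / 2)) (by rw [abs_neg, abs_of_pos (by linarith)]; linarith)
  constructor <;> linarith

lemma santalo {m : ℕ} {s : ℝ} (h0 : 0 < s) (h3 : 3 * s ^ 2 = 1) :
    IsSantaloPoint (body m) (s • e0 m) := by
  have h1 : s < 1 := by nlinarith
  refine ⟨axis_interior h0 h1, fun y hy => ?_⟩
  obtain ⟨t0, t1⟩ := interior_coord hy
  refine mul_le_mul' le_rfl ?_
  rw [← ENNReal.mul_le_mul_iff_right (Gn_ne_zero m) (Gn_ne_top m),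
    ← F_eq (interior_subset hy), ← F_eq (interior_subset (axis_interior h0 h1))]
  refine le_trans ?_ (F_symm y)
  rw [F_axis h0 h1, F_axis t0 t1, ← mul_assoc, ← mul_assoc]
  set t := y 0
  have : 0 < 1 - s := by linarith
  have : 0 < 1 - t := by linarith
  rw [← ENNReal.ofReal_mul (by positivity), ← ENNReal.ofReal_mul (by positivity)]
  gcongr ?_ * _
  apply ENNReal.ofReal_le_ofReal
  rw [div_mul_div_comm, div_mul_div_comm]
  have : t * (1 - t) * (1 + t) ≤ s * (1 - s) * (1 + s) := by
    nlinarith [mul_nonneg (sq_nonneg (s - t)) (by linarith : 0 ≤ 2 * s + t)]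
  gcongr


lemma R_preimage (m : ℕ) : R m ⁻¹' body m = body m := by
  ext x; exact body_R x

lemma integral_R (m : ℕ) : R m (∫ x in body m, x) = ∫ x in body m, x := by
  have h1 : ∫ x in body m, R m x = R m (∫ x in body m, x) :=
    (R m).toContinuousLinearEquiv.integral_comp_comm (fun x => x)
  rw [← h1]
  have := (R_mp m).setIntegral_preimage_emb (R m).toHomeomorph.measurableEmbedding
    (fun x => x) (body m)
  rwa [R_preimage] at this

lemma centroid_axis (m : ℕ) : centroid (body m) = (centroid (body m) 0) • e0 m := by
  have h : R m (centroid (body m)) = centroid (body m) := by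
    rw [centroid, map_smul, integral_R]
  ext i
  refine Fin.cases ?_ (fun i => ?_) i
  · simp [e0]
  · have h2 := R_succ (centroid (body m)) i
    rw [h] at h2
    simp [e0]
    linarith

def Q (m : ℕ) : Set (Fin m → ℝ) := Icc (fun _ => -1) (fun _ => 1)

def body' (m : ℕ) : Set (ℝ × (ℝ × (Fin m → ℝ))) :=
  {p | 0 ≤ p.1 ∧ p.1 ≤ 1 ∧ |p.2.1| ≤ 1 + p.1 ∧ p.2.2 ∈ Q m}

lemma body_pre (m : ℕ) : Psi m ⁻¹' body' m = body m := by
  ext x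
  simp [body, body', Psi, Q, Pi.le_def, abs_le, forall_and]

lemma body'_closed (m : ℕ) : IsClosed (body' m) := by
  have : body' m = {p | 0 ≤ p.1} ∩ ({p | p.1 ≤ 1} ∩ ({p | |p.2.1| ≤ 1 + p.1} ∩
      {p | p.2.2 ∈ Q m})) := by
    ext x; simp [body']
  rw [this]
  refine (isClosed_le (by fun_prop) (by fun_prop)).inter ((isClosed_le (by fun_prop) (by fun_prop)).inter
    ((isClosed_le (by fun_prop) (by fun_prop)).inter ?_))
  exact (isClosed_Icc (a := fun _ : Fin m => (-1:ℝ)) (b := fun _ => 1)).preimage (by fun_prop)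

lemma body'_compact (m : ℕ) : IsCompact (body' m) := by
  have h : IsCompact (Icc (0:ℝ) 1 ×ˢ (Icc (-2:ℝ) 2 ×ˢ Q m)) :=
    isCompact_Icc.prod (isCompact_Icc.prod isCompact_Icc)
  refine h.of_isClosed_subset (body'_closed m) ?_
  rintro p ⟨h0, h1, h2, h3⟩
  rw [abs_le] at h2
  exact ⟨⟨h0, h1⟩, ⟨by linarith, by linarith⟩, h3⟩

lemma moment {m : ℕ} (φ : ℝ → ℝ) (hφ : Continuous φ) :
    ∫ x in body m, φ (x 0) =
      (∫ t in (0:ℝ)..1, φ t * (2 * (1 + t))) * (volume : Measure (Fin m → ℝ)).real (Q m) := by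
  have h1 : ∫ x in body m, φ (x 0) = ∫ p in body' m, φ p.1 := by
    rw [← (Psi_mp m).map_eq, setIntegral_map (body'_closed m).measurableSet
      (by fun_prop) (Psi_mp m).measurable.aemeasurable, body_pre]
    rfl
  have hintg : Integrable ((body' m).indicator (fun p => φ p.1)) := by
    rw [integrable_indicator_iff (body'_closed m).measurableSet]
    exact ContinuousOn.integrableOn_compact (body'_compact m) (by fun_prop)
  rw [h1, ← integral_indicator (body'_closed m).measurableSet]
  rw [Measure.volume_eq_prod] at hintg ⊢
  rw [integral_prod _ hintg, intervalIntegral.integral_of_le zero_le_one,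
    ← integral_Icc_eq_integral_Ioc, ← integral_mul_const, ← integral_indicator measurableSet_Icc]
  congr 1
  ext t
  by_cases ht : t ∈ Icc (0:ℝ) 1
  · have e : ∀ q : ℝ × (Fin m → ℝ), (body' m).indicator (fun p => φ p.1) (t, q) =
        (Icc (-(1 + t)) (1 + t) ×ˢ Q m).indicator (fun _ => φ t) q := by
      intro q
      have : (t, q) ∈ body' m ↔ q ∈ Icc (-(1 + t)) (1 + t) ×ˢ Q m := by
        simp only [body', mem_ofPred_eq, mem_prod, mem_Icc, abs_le]
        exact ⟨fun h => h.2.2, fun h => ⟨ht.1, ht.2, h⟩⟩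
      by_cases hq : q ∈ Icc (-(1 + t)) (1 + t) ×ˢ Q m
      · rw [indicator_of_mem hq, indicator_of_mem (this.2 hq)]
      · rw [indicator_of_notMem hq, indicator_of_notMem (fun h => hq (this.1 h))]
    simp only [e]
    rw [integral_indicator_const _ (measurableSet_Icc.prod (show MeasurableSet (Q m) from measurableSet_Icc)), indicator_of_mem ht,
      Measure.volume_eq_prod, measureReal_prod_prod, Real.volume_real_Icc_of_le (by linarith [ht.1]),
      smul_eq_mul]
    ring
  · have e : ∀ q : ℝ × (Fin m → ℝ), (body' m).indicator (fun p => φ p.1) (t, q) = 0 := by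
      intro q
      exact indicator_of_notMem (fun h => ht ⟨h.1, h.2.1⟩) _
    simp [e, ht]

lemma Q_pos (m : ℕ) : 0 < (volume : Measure (Fin m → ℝ)).real (Q m) := by
  rw [Q, Measure.real, Real.volume_Icc_pi_toReal]
  · simp
  · intro i; norm_num

lemma centroid_zero (m : ℕ) : centroid (body m) 0 = 5 / 9 := by
  have hv : (volume (body m)).toReal = 3 * (volume : Measure (Fin m → ℝ)).real (Q m) := by
    have h := moment (m := m) (fun _ => 1) continuous_const
    have i1 : ∫ t in (0:ℝ)..1, 1 * (2 * (1 + t)) = 3 := by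
      rw [intervalIntegral.integral_congr (g := fun t => 2 + 2 * t) (fun t _ => by simp only []; ring),
        intervalIntegral.integral_add (Continuous.intervalIntegrable (by fun_prop) _ _)
        (Continuous.intervalIntegrable (by fun_prop) _ _), intervalIntegral.integral_const_mul,
        integral_id]
      simp; norm_num
    rw [i1] at h
    simpa [Measure.real] using h
  have hI : (∫ x in body m, x) 0 = 5 / 3 * (volume : Measure (Fin m → ℝ)).real (Q m) := by
    have h := moment (m := m) (fun t => t) continuous_id
    have i1 : ∫ t in (0:ℝ)..1, t * (2 * (1 + t)) = 5 / 3 := by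
      have : ∀ t : ℝ, t * (2 * (1 + t)) = 2 * t + 2 * t ^ 2 := fun t => by ring
      simp only [this]
      rw [intervalIntegral.integral_add (Continuous.intervalIntegrable (by fun_prop) _ _)
        (Continuous.intervalIntegrable (by fun_prop) _ _), intervalIntegral.integral_const_mul, intervalIntegral.integral_const_mul,
        integral_id, integral_pow]
      norm_num
    rw [i1] at h
    rw [← h]
    exact ((EuclideanSpace.proj (𝕜 := ℝ) (0 : Fin (m + 2))).integral_comp_comm
      (ContinuousOn.integrableOn_compact (body_compact m) continuousOn_id)).symm
  have := Q_pos m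
  rw [centroid, PiLp.smul_apply, hv, hI, smul_eq_mul]
  field_simp
  norm_num

lemma supp_e0 (m : ℕ) : suppFn (body m) (e0 m) = 1 := by
  apply IsGreatest.csSup_eq
  constructor
  · exact ⟨wit 0 1, wit_mem _ zero_le_one le_rfl, by simp only [inner_e0, wit_zero]⟩
  · rintro _ ⟨x, hx, rfl⟩
    simp only [inner_e0]; exact hx.2.1

lemma supp_neg_e0 (m : ℕ) : suppFn (body m) (-(e0 m)) = 0 := by
  apply IsGreatest.csSup_eq
  constructor
  · exact ⟨wit 0 0, wit_mem _ le_rfl zero_le_one, by simp only [inner_neg_left, inner_e0, wit_zero, neg_zero]⟩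
  · rintro _ ⟨x, hx, rfl⟩
    simp only [inner_neg_left, inner_e0]; linarith [hx.1]

end SantaloAux

/-- There is an absolute constant `c > 0` and `n₀ ∈ ℕ` such that for all `n ≥ n₀` there is a
convex body `C` in `ℝⁿ` with `c ≤ ‖g(C) - s(C)‖₂ / w_C(u)`, where `u` is the unit vector in
direction `g(C) - s(C)` and `w_C(u) = h_C(u) + h_C(-u)` is the width of `C` in direction `u`. -/
theorem santalo_centroid_far_apart :
    ∃ c : ℝ, 0 < c ∧ ∃ n₀ : ℕ, ∀ n ≥ n₀,
      ∃ C : Set (EuclideanSpace ℝ (Fin n)),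
        IsCompact C ∧ Convex ℝ C ∧ (interior C).Nonempty ∧
        ∃ s : EuclideanSpace ℝ (Fin n), IsSantaloPoint C s ∧
          c ≤ ‖centroid C - s‖ /
              (suppFn C (‖centroid C - s‖⁻¹ • (centroid C - s)) +
               suppFn C (-(‖centroid C - s‖⁻¹ • (centroid C - s)))) := by
  refine ⟨1 / 100, by norm_num, 2, fun n hn => ?_⟩
  obtain ⟨m, rfl⟩ : ∃ m, n = m + 2 := ⟨n - 2, by omega⟩
  have hs3 : 3 * (Real.sqrt (1 / 3)) ^ 2 = 1 := by
    rw [Real.sq_sqrt (by norm_num)]; norm_num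
  have hs0 : 0 < Real.sqrt (1 / 3) := Real.sqrt_pos.2 (by norm_num)
  set s := Real.sqrt (1 / 3)
  refine ⟨SantaloAux.body m, SantaloAux.body_compact m, SantaloAux.body_convex m,
    ⟨_, SantaloAux.axis_interior (t := 1 / 2) (by norm_num) (by norm_num)⟩,
    s • SantaloAux.e0 m, SantaloAux.santalo hs0 hs3, ?_⟩
  have hd : 1 / 100 ≤ s - 5 / 9 := by nlinarith
  have hdiff : centroid (SantaloAux.body m) - s • SantaloAux.e0 m
      = (-(s - 5 / 9)) • SantaloAux.e0 m := by
    rw [SantaloAux.centroid_axis, SantaloAux.centroid_zero, ← sub_smul]; congr 1; ring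
  have hnorm : ‖(-(s - 5 / 9)) • SantaloAux.e0 m‖ = s - 5 / 9 := by
    rw [norm_smul, SantaloAux.e0_norm, mul_one, norm_neg, Real.norm_of_nonneg (by linarith)]
  have hu : (s - 5 / 9)⁻¹ • ((-(s - 5 / 9)) • SantaloAux.e0 m) = -(SantaloAux.e0 m) := by
    rw [smul_smul, mul_neg, inv_mul_cancel₀ (by linarith), neg_one_smul]
  rw [hdiff, hnorm, hu, neg_neg, SantaloAux.supp_e0, SantaloAux.supp_neg_e0]
  simpa using hd
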